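/- For every positive integer i, 3·n_i ≤ n_{i+1}; in particular the quotient n_{i+1}/n_i is at least 3. -/

import Mathlib

/-- `sigma n` is the largest positive integer `ℓ` with `n + (ℓ - 1) ≤ e * (n!)^(1/n)`. -/
noncomputable def sigma (n : ℕ) : ℕ :=
  sSup {ℓ : ℕ | 0 < ℓ ∧ (n : ℝ) + ((ℓ : ℝ) - 1) ≤ Real.exp 1 * (n.factorial : ℝ) ^ ((1 : ℝ) / n)}

/-- `nSeq i` is the `i`-th term (1-indexed) of the increasing enumeration of the set of
positive integers `n` with `sigma (n+1) = sigma n + 1`. -/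
noncomputable def nSeq (i : ℕ) : ℕ :=
  Nat.nth (fun n => 0 < n ∧ sigma (n + 1) = sigma n + 1) (i - 1)

open Real Stirling

/-- The quantity `e * (n!)^(1/n) - n` whose integer part governs `sigma n`. -/
noncomputable def excess (n : ℕ) : ℝ :=
  Real.exp 1 * (n.factorial : ℝ) ^ ((1 : ℝ) / n) - n

/-- The logarithm of `n! / (n/e)^n`. -/
noncomputable def stirlingLog (n : ℕ) : ℝ :=
  Real.log n.factorial - n * Real.log n + n

lemma excess_eq {n : ℕ} (hn : 0 < n) :
    excess n = n * Real.exp (stirlingLog n / n) - n := by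
  have h0 : (0 : ℝ) < n := by exact_mod_cast hn
  have hf : (0 : ℝ) < n.factorial := by exact_mod_cast n.factorial_pos
  rw [excess, rpow_def_of_pos hf, ← Real.exp_add]
  nth_rewrite 3 [← Real.exp_log h0]
  rw [← Real.exp_add]
  congr 2
  unfold stirlingLog
  field_simp
  ring

lemma stirlingLog_eq {n : ℕ} (hn : 0 < n) :
    stirlingLog n = Real.log (stirlingSeq n) + 1 / 2 * (Real.log 2 + Real.log n) := by
  have h0 : (n : ℝ) ≠ 0 := by positivity
  rw [log_stirlingSeq_formula, Real.log_mul two_ne_zero h0, Real.log_div h0 (by positivity),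
    Real.log_exp, stirlingLog]
  ring

lemma log_stirlingSeq_nonneg {n : ℕ} (hn : 0 < n) : 0 ≤ Real.log (stirlingSeq n) := by
  apply Real.log_nonneg
  refine le_trans ?_ (sqrt_pi_le_stirlingSeq hn.ne')
  rw [Real.one_le_sqrt]
  linarith [Real.pi_gt_three]

lemma half_log_le_stirlingLog {n : ℕ} (hn : 0 < n) : 1 / 2 * Real.log n ≤ stirlingLog n := by
  rw [stirlingLog_eq hn]
  have := log_stirlingSeq_nonneg hn
  have := Real.log_nonneg (one_le_two : (1 : ℝ) ≤ 2)
  linarith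

lemma stirlingLog_nonneg {n : ℕ} (hn : 0 < n) : 0 ≤ stirlingLog n := by
  have h1 := half_log_le_stirlingLog hn
  have : 0 ≤ Real.log n := Real.log_natCast_nonneg n
  linarith

lemma stirlingLog_sub_le {m n : ℕ} (hm : 0 < m) (hmn : m ≤ n) :
    stirlingLog n - stirlingLog m ≤ 1 / 2 * (Real.log n - Real.log m) := by
  rw [stirlingLog_eq hm, stirlingLog_eq (hm.trans_le hmn)]
  obtain ⟨a, rfl⟩ : ∃ a, m = a + 1 := ⟨m - 1, by omega⟩
  obtain ⟨b, rfl⟩ : ∃ b, n = b + 1 := ⟨n - 1, by omega⟩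
  have := log_stirlingSeq'_antitone (show a ≤ b by omega)
  simp only [Function.comp, Nat.succ_eq_add_one] at this
  linarith

lemma log_succ_sub_log {n : ℕ} (hn : 0 < n) :
    Real.log ((n + 1 : ℕ) : ℝ) - Real.log n = Real.log (1 + 1 / (n : ℝ)) := by
  have h0 : (0 : ℝ) < n := by exact_mod_cast hn
  rw [← Real.log_div (by positivity) h0.ne']
  congr 1
  push_cast
  field_simp

lemma stirlingLog_succ_sub_le {n : ℕ} (hn : 0 < n) :
    stirlingLog (n + 1) - stirlingLog n ≤ 1 / (2 * n) := by
  have h0 : (0 : ℝ) < n := by exact_mod_cast hn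
  have h1 := stirlingLog_sub_le hn n.le_succ
  rw [Nat.succ_eq_add_one, log_succ_sub_log hn] at h1
  have h2 := Real.log_le_sub_one_of_pos (show (0 : ℝ) < 1 + 1 / n by positivity)
  have h3 : (1 : ℝ) / (2 * n) = 1 / 2 * (1 / n) := by field_simp
  linarith

lemma le_stirlingLog_succ_sub {n : ℕ} (hn : 0 < n) :
    1 / (2 * n) - 1 / (3 * (n : ℝ) ^ 2) ≤ stirlingLog (n + 1) - stirlingLog n := by
  have h0 : (0 : ℝ) < n := by exact_mod_cast hn
  have h1 := log_stirlingSeq_sdiff_le n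
  have h2 := log_succ_sub_log hn
  have h3 := Real.le_log_one_add_of_nonneg (show (0 : ℝ) ≤ 1 / n by positivity)
  rw [stirlingLog_eq hn, stirlingLog_eq n.succ_pos]
  have h4 : 2 * (1 / (n : ℝ)) / (1 / n + 2) = 2 / (2 * n + 1) := by field_simp; ring
  have h5 : 1 / (2 * n) - 1 / (3 * (n : ℝ) ^ 2) + 1 / (12 * n * (n + 1)) ≤ 1 / (2 * n + 1) := by
    rw [← sub_nonneg]
    have : 1 / (2 * (n : ℝ) + 1) - (1 / (2 * n) - 1 / (3 * (n : ℝ) ^ 2) + 1 / (12 * n * (n + 1)))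
        = (5 * n + 4) / (12 * n ^ 2 * (n + 1) * (2 * n + 1)) := by
      field_simp
      ring
    rw [this]
    positivity
  have h6 : (2 : ℝ) / (2 * n + 1) = 2 * (1 / (2 * n + 1)) := by ring
  linarith

lemma stirlingLog_three_sq_le : stirlingLog 3 ^ 2 ≤ 7 / 3 := by
  have h0 : 0 ≤ stirlingLog 3 := stirlingLog_nonneg (by norm_num)
  have h1 : stirlingLog 3 ≤ 3 / 2 := by
    have h2 : stirlingLog 3 = Real.log (2 / 9) + 3 := by
      have h6 : ((Nat.factorial 3 : ℕ) : ℝ) = 2 * 3 := by norm_num [Nat.factorial]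
      rw [stirlingLog, h6, Real.log_div (by norm_num) (by norm_num),
        Real.log_mul (by norm_num) (by norm_num), show (9 : ℝ) = 3 ^ 2 by norm_num, Real.log_pow]
      push_cast
      ring
    have h3 : 2 * Real.log (2 / 9) ≤ -3 := by
      have h4 : 2 * Real.log (2 / 9) = Real.log ((2 / 9) ^ 2) := by rw [Real.log_pow]; norm_num
      rw [h4, Real.log_le_iff_le_exp (by norm_num), Real.exp_neg]
      have h5 : Real.exp 3 = Real.exp 1 ^ 3 := by rw [← Real.exp_nat_mul]; norm_num
      have h6 : Real.exp 1 ^ 3 ≤ 2.72 ^ 3 := by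
        have := Real.exp_one_lt_d9
        gcongr
        linarith
      rw [h5, show ((2 : ℝ) / 9) ^ 2 = (81 / 4)⁻¹ by norm_num]
      apply inv_anti₀ (by positivity)
      refine h6.trans (by norm_num)
    linarith
  nlinarith

lemma stirlingLog_sq_le {n : ℕ} (hn : 3 ≤ n) : stirlingLog n ^ 2 ≤ n - 2 / 3 := by
  induction n, hn using Nat.le_induction with
  | base => have := stirlingLog_three_sq_le; norm_num at this ⊢; linarith
  | succ n hn ih =>
    have h3 : (3 : ℝ) ≤ n := by exact_mod_cast hn
    have hs := stirlingLog_nonneg (show 0 < n by omega)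
    have hs' := stirlingLog_nonneg n.succ_pos
    have hd := stirlingLog_succ_sub_le (show 0 < n by omega)
    set s := stirlingLog n
    have h1 : stirlingLog (n + 1) ^ 2 ≤ (s + 1 / (2 * n)) ^ 2 :=
      pow_le_pow_left₀ hs' (by linarith) 2
    have h2 : (s + 1 / (2 * (n : ℝ))) ^ 2 ≤ s ^ 2 + 1 := by
      have h4 : (s + 1 / (2 * (n : ℝ))) ^ 2 = s ^ 2 + (4 * n * s + 1) / (4 * n ^ 2) := by
        field_simp
        ring
      rw [h4]
      gcongr
      rw [div_le_one (by positivity)]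
      nlinarith [sq_nonneg (s - 1)]
    push_cast
    linarith

lemma one_le_exp_mul {u : ℝ} (hu : 0 ≤ u) : 1 ≤ Real.exp u * (1 - u + u ^ 2 / 2) := by
  have h1 := Real.quadratic_le_exp_of_nonneg hu
  have h2 : 0 ≤ 1 - u + u ^ 2 / 2 := by nlinarith [sq_nonneg (u - 1)]
  calc (1 : ℝ) ≤ (1 + u + u ^ 2 / 2) * (1 - u + u ^ 2 / 2) := by nlinarith [sq_nonneg (u ^ 2)]
    _ ≤ _ := by gcongr

lemma exp_tangent (u v : ℝ) : Real.exp u * (1 + v - u) ≤ Real.exp v := by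
  have h := Real.add_one_le_exp (v - u)
  calc Real.exp u * (1 + v - u) ≤ Real.exp u * Real.exp (v - u) := by gcongr; linarith
    _ = _ := by rw [← Real.exp_add]; congr 1; ring

lemma excess_le_succ_of_three_le {n : ℕ} (hn : 3 ≤ n) : excess n ≤ excess (n + 1) := by
  have hn0 : 0 < n := by omega
  have h0 : (0 : ℝ) < n := by exact_mod_cast hn0
  rw [excess_eq hn0, excess_eq n.succ_pos]
  have hs := stirlingLog_nonneg hn0
  have hd := le_stirlingLog_succ_sub hn0
  have hsq := stirlingLog_sq_le hn
  set s := stirlingLog n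
  set t := stirlingLog (n + 1)
  have ht := exp_tangent (s / n) (t / (n + 1 : ℕ))
  push_cast at ht ⊢
  have h1 := one_le_exp_mul (show 0 ≤ s / n by positivity)
  have h2 : (s / n) ^ 2 / 2 ≤ t - s := by
    refine le_trans ?_ hd
    have : 1 / (2 * n) - 1 / (3 * (n : ℝ) ^ 2) = (n - 2 / 3) / n ^ 2 / 2 := by field_simp
    rw [this, div_pow]
    gcongr
  have h3 : (n + 1 : ℝ) * (1 + t / (n + 1) - s / n) - n = 1 - s / n + (t - s) := by
    field_simp
    ring
  have h4 : Real.exp (s / n) * (1 - s / n + (s / n) ^ 2 / 2) ≤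
      Real.exp (s / n) * (1 - s / n + (t - s)) := by gcongr
  rw [← h3] at h4
  have h5 := mul_le_mul_of_nonneg_left ht (show (0 : ℝ) ≤ n + 1 by positivity)
  linarith

lemma excess_one : excess 1 = Real.exp 1 - 1 := by simp [excess]

lemma excess_two : excess 2 = Real.exp 1 * √2 - 2 := by
  simp [excess, Real.sqrt_eq_rpow]

lemma cbrt_six_bounds : (1.8 : ℝ) ≤ (6 : ℝ) ^ ((1 : ℝ) / 3) ∧ (6 : ℝ) ^ ((1 : ℝ) / 3) ≤ 1.9 := by
  have h0 : (0 : ℝ) ≤ (6 : ℝ) ^ ((1 : ℝ) / 3) := by positivity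
  have h : ((6 : ℝ) ^ ((1 : ℝ) / 3)) ^ 3 = 6 := by
    rw [← Real.rpow_natCast, ← Real.rpow_mul (by norm_num)]; norm_num
  constructor
  · refine le_of_pow_le_pow_left₀ three_ne_zero h0 ?_
    rw [h]; norm_num
  · refine le_of_pow_le_pow_left₀ three_ne_zero (by norm_num) ?_
    rw [h]; norm_num

lemma excess_three : excess 3 = Real.exp 1 * (6 : ℝ) ^ ((1 : ℝ) / 3) - 3 := by
  norm_num [excess, Nat.factorial]

lemma excess_le_succ {n : ℕ} (hn : 0 < n) : excess n ≤ excess (n + 1) := by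
  have he := Real.exp_one_gt_d9
  rcases (by omega : n = 1 ∨ n = 2 ∨ 3 ≤ n) with rfl | rfl | h
  · rw [excess_one, excess_two]
    have : (1.4 : ℝ) ≤ √2 := Real.le_sqrt_of_sq_le (by norm_num)
    nlinarith
  · rw [excess_two, excess_three]
    have : √2 ≤ (1.42 : ℝ) := Real.sqrt_le_iff.2 (by norm_num)
    nlinarith [cbrt_six_bounds.1]
  · exact excess_le_succ_of_three_le h

lemma excess_mono {m n : ℕ} (hm : 0 < m) (hmn : m ≤ n) : excess m ≤ excess n := by
  induction n, hmn using Nat.le_induction with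
  | base => exact le_rfl
  | succ n hn ih => exact ih.trans (excess_le_succ (hm.trans_le hn))

lemma log_three_le : Real.log 3 ≤ 1.2 := by
  rw [Real.log_le_iff_le_exp (by norm_num)]
  have h : Real.exp 1.2 = Real.exp 1 * Real.exp 0.2 := by rw [← Real.exp_add]; norm_num
  rw [h]
  have h1 := Real.exp_one_gt_d9
  have h2 := Real.add_one_le_exp 0.2
  nlinarith

lemma excess_three_mul_le {n : ℕ} (hn : 0 < n) : excess (3 * n) ≤ excess n + 1 := by
  rcases (by omega : n = 1 ∨ 2 ≤ n) with rfl | h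
  · rw [mul_one, excess_one, excess_three]
    nlinarith [cbrt_six_bounds.2, Real.exp_one_lt_d9, Real.exp_pos 1]
  have h2 : (2 : ℝ) ≤ n := by exact_mod_cast h
  have h0 : (0 : ℝ) < n := by linarith
  have hN : 0 < 3 * n := by omega
  rw [excess_eq hn, excess_eq hN]
  have hd := stirlingLog_sub_le hn (show n ≤ 3 * n by omega)
  have hsq := stirlingLog_sq_le (show 3 ≤ 3 * n by omega)
  have ht0 := stirlingLog_nonneg hN
  push_cast at hd hsq ⊢
  rw [Real.log_mul three_ne_zero h0.ne'] at hd
  set s := stirlingLog n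
  set t := stirlingLog (3 * n)
  have hv : t / (3 * n) ≤ 0.4 := by
    rw [div_le_iff₀ (by positivity)]
    refine le_of_pow_le_pow_left₀ two_ne_zero (by positivity) ?_
    nlinarith
  have hT := exp_tangent (t / (3 * n)) (s / n)
  have h1 : Real.exp (t / (3 * n)) * (1 - t / (3 * n)) ≤ 1 := by
    have := exp_tangent (t / (3 * n)) 0
    simpa using this
  have h3 : (3 * n : ℝ) - n * (1 + s / n - t / (3 * n)) = 2 * n - s + t / 3 := by
    field_simp
    ring
  have h4 : 2 * n - s + t / 3 ≤ (2 * n + 1) * (1 - t / (3 * n)) := by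
    have h5 : (2 * n + 1) * (1 - t / (3 * n)) = 2 * n + 1 - 2 * t / 3 - t / (3 * n) := by
      field_simp
      ring
    rw [h5]
    linarith [log_three_le]
  have h6 := mul_le_mul_of_nonneg_left h4 (Real.exp_pos (t / (3 * n))).le
  rw [← h3] at h6
  have h7 := mul_le_mul_of_nonneg_left hT h0.le
  have h8 := mul_le_mul_of_nonneg_left h1 (show (0 : ℝ) ≤ 2 * n + 1 by positivity)
  linarith

lemma stirlingLog_le_excess {n : ℕ} (hn : 0 < n) : stirlingLog n ≤ excess n := by
  have h0 : (0 : ℝ) < n := by exact_mod_cast hn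
  rw [excess_eq hn]
  have h := mul_le_mul_of_nonneg_left (Real.add_one_le_exp (stirlingLog n / n)) h0.le
  rw [mul_add, mul_div_cancel₀ _ h0.ne'] at h
  linarith

lemma excess_nonneg {n : ℕ} (hn : 0 < n) : 0 ≤ excess n :=
  (stirlingLog_nonneg hn).trans (stirlingLog_le_excess hn)

lemma sigma_eq {n : ℕ} (hn : 0 < n) : sigma n = ⌊excess n⌋₊ + 1 := by
  refine IsGreatest.csSup_eq ⟨⟨Nat.succ_pos _, ?_⟩, ?_⟩
  · have := Nat.floor_le (excess_nonneg hn)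
    unfold excess at this ⊢
    push_cast
    linarith
  · rintro l ⟨hl, h⟩
    obtain ⟨k, rfl⟩ : ∃ k, l = k + 1 := ⟨l - 1, by omega⟩
    have : k ≤ ⌊excess n⌋₊ := by
      apply Nat.le_floor
      unfold excess
      push_cast at h
      linarith
    omega

lemma sigma_mono {m n : ℕ} (hm : 0 < m) (hmn : m ≤ n) : sigma m ≤ sigma n := by
  rw [sigma_eq hm, sigma_eq (hm.trans_le hmn)]
  gcongr
  exact excess_mono hm hmn

lemma sigma_three_mul_le {n : ℕ} (hn : 0 < n) : sigma (3 * n) ≤ sigma n + 1 := by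
  rw [sigma_eq hn, sigma_eq (by omega : 0 < 3 * n), ← Nat.floor_add_one (excess_nonneg hn)]
  gcongr
  exact excess_three_mul_le hn

lemma exists_lt_sigma (B : ℕ) : ∃ n, 0 < n ∧ B < sigma n := by
  obtain ⟨n, hn⟩ := exists_nat_gt (Real.exp (2 * B))
  have h0 : (0 : ℝ) < n := (Real.exp_pos _).trans hn
  have hn0 : 0 < n := by exact_mod_cast h0
  refine ⟨n, hn0, ?_⟩
  rw [sigma_eq hn0, Nat.lt_succ_iff]
  apply Nat.le_floor
  have h1 : 2 * (B : ℝ) < Real.log n := (Real.lt_log_iff_exp_lt h0).2 hn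
  linarith [half_log_le_stirlingLog hn0, stirlingLog_le_excess hn0]

lemma infinite_sigma_jumps :
    {n : ℕ | 0 < n ∧ sigma (n + 1) = sigma n + 1}.Infinite := by
  intro hfin
  obtain ⟨B, hB⟩ := hfin.bddAbove
  have hconst : ∀ n, B + 1 ≤ n → sigma n ≤ sigma (B + 1) := by
    intro n hn
    induction n, hn using Nat.le_induction with
    | base => exact le_rfl
    | succ n hn ih =>
      have hn0 : 0 < n := by omega
      have h1 : sigma (n + 1) ≤ sigma n + 1 :=
        (sigma_mono n.succ_pos (by omega)).trans (sigma_three_mul_le hn0)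
      by_contra hlt
      have h2 := hB (show n ∈ {n : ℕ | 0 < n ∧ sigma (n + 1) = sigma n + 1} from
        ⟨hn0, by omega⟩)
      omega
  obtain ⟨n, hn, hlt⟩ := exists_lt_sigma (sigma (B + 1))
  have h1 := hconst (max n (B + 1)) (le_max_right _ _)
  have h2 := sigma_mono hn (le_max_left n (B + 1))
  omega

lemma three_mul_le_of_sigma_jumps {m n : ℕ} (hm : 0 < m) (hmn : m < n)
    (hjm : sigma (m + 1) = sigma m + 1) (hjn : sigma (n + 1) = sigma n + 1) : 3 * m ≤ n := by
  by_contra! h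
  have h1 := sigma_mono m.succ_pos (show m + 1 ≤ n from hmn)
  have h2 := sigma_mono n.succ_pos (show n + 1 ≤ 3 * m from h)
  have h3 := sigma_three_mul_le hm
  simp only [Nat.succ_eq_add_one] at h1 h2
  omega

theorem stmt18 : ∀ i : ℕ, 1 ≤ i →
    3 * nSeq i ≤ nSeq (i + 1) ∧ (3 : ℝ) ≤ (nSeq (i + 1) : ℝ) / (nSeq i : ℝ) := by
  intro i hi
  have hm := Nat.nth_mem_of_infinite infinite_sigma_jumps (i - 1)
  have hn := Nat.nth_mem_of_infinite infinite_sigma_jumps (i + 1 - 1)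
  have hlt := Nat.nth_strictMono infinite_sigma_jumps (show i - 1 < i + 1 - 1 by omega)
  have key : 3 * nSeq i ≤ nSeq (i + 1) := three_mul_le_of_sigma_jumps hm.1 hlt hm.2 hn.2
  have hpos : (0 : ℝ) < nSeq i := by exact_mod_cast hm.1
  refine ⟨key, ?_⟩
  rw [le_div_iff₀ hpos]
  exact_mod_cast key
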